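/- The FRSD iterates satisfy, for every k ≥ 1, ‖x(k+1) − x̂(k+1)‖_C ≤ (σ_C + α κ₄ nL) ‖x(k) − x̂(k)‖_C + (κ₂ |||R|||_R + α κ₄ ṽ L) ‖x(k) − x(k−1)‖_R + α κ₄ nL ‖x̂(k) − x*_vec‖ + α κ₄ (2 + v) ṽ² √n κ₃ σ_R^{k−1} ‖∇f(x(k))‖. -/

import Mathlib

open Matrix Filter
open scoped Kronecker

noncomputable section

/-- Euclidean norm on `ι → ℝ`. -/
def eucNorm {ι : Type*} [Fintype ι] (z : ι → ℝ) : ℝ := Real.sqrt (∑ i, z i ^ 2)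

/-- Spectral norm (operator 2-norm) of a square real matrix. -/
def specNorm {ι : Type*} [Fintype ι] (A : Matrix ι ι ℝ) : ℝ :=
  sSup {c : ℝ | ∃ z : ι → ℝ, eucNorm z ≤ 1 ∧ c = eucNorm (A.mulVec z)}

/-- Matrix norm induced by a vector norm `N`: `sup_{z ≠ 0} N (A z) / N z`. -/
def opNorm {ι : Type*} [Fintype ι] (N : (ι → ℝ) → ℝ) (A : Matrix ι ι ℝ) : ℝ :=
  sSup {c : ℝ | ∃ z : ι → ℝ, z ≠ 0 ∧ c = N (A.mulVec z) / N z}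

/-- `g` is the gradient of `f : ℝ^p → ℝ`. -/
def IsGradient {p : ℕ} (f : (Fin p → ℝ) → ℝ) (g : (Fin p → ℝ) → Fin p → ℝ) : Prop :=
  ∀ x, HasFDerivAt f (∑ j, g x j • (ContinuousLinearMap.proj j : (Fin p → ℝ) →L[ℝ] ℝ)) x

/-- `R = R̄ ⊗ I_p`. -/
def RK (n p : ℕ) (Rb : Matrix (Fin n) (Fin n) ℝ) :
    Matrix (Fin n × Fin p) (Fin n × Fin p) ℝ :=
  Rb ⊗ₖ (1 : Matrix (Fin p) (Fin p) ℝ)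

/-- `V_∞ = (1_n π^T) ⊗ I_p`. -/
def VinfK (n p : ℕ) (π : Fin n → ℝ) :
    Matrix (Fin n × Fin p) (Fin n × Fin p) ℝ :=
  (Matrix.of (fun _ j => π j) : Matrix (Fin n) (Fin n) ℝ) ⊗ₖ (1 : Matrix (Fin p) (Fin p) ℝ)

/-- `V(k) = R̄^k ⊗ I_p`. -/
def VK (n p : ℕ) (Rb : Matrix (Fin n) (Fin n) ℝ) (k : ℕ) :
    Matrix (Fin n × Fin p) (Fin n × Fin p) ℝ :=
  (Rb ^ k) ⊗ₖ (1 : Matrix (Fin p) (Fin p) ℝ)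

/-- `Ṽ(k)⁻¹ = diag(((R̄^k)_{11})⁻¹, …, ((R̄^k)_{nn})⁻¹) ⊗ I_p`. -/
def VtinvK (n p : ℕ) (Rb : Matrix (Fin n) (Fin n) ℝ) (k : ℕ) :
    Matrix (Fin n × Fin p) (Fin n × Fin p) ℝ :=
  Matrix.diagonal (fun q => ((Rb ^ k) q.1 q.1)⁻¹)

/-- `∇f(z) = (∇f_1(z_1), …, ∇f_n(z_n))` block-wise. -/
def gradf {n p : ℕ} (g : Fin n → (Fin p → ℝ) → Fin p → ℝ) (z : Fin n × Fin p → ℝ) :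
    Fin n × Fin p → ℝ :=
  fun q => g q.1 (fun j => z (q.1, j)) q.2

/-- `x*_vec = 1_n ⊗ x*`. -/
def starVec (n p : ℕ) (xstar : Fin p → ℝ) : Fin n × Fin p → ℝ := fun q => xstar q.2

end

section helpers

variable {ι : Type*} [Fintype ι]

theorem euc_eq (z : ι → ℝ) : eucNorm z = ‖(WithLp.toLp 2 z : EuclideanSpace ℝ ι)‖ := by
  rw [EuclideanSpace.norm_eq]; simp [eucNorm]

theorem euc_nonneg (z : ι → ℝ) : 0 ≤ eucNorm z := Real.sqrt_nonneg _

theorem euc_add (z w : ι → ℝ) : eucNorm (z + w) ≤ eucNorm z + eucNorm w := by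
  simp only [euc_eq, WithLp.toLp_add]; exact norm_add_le _ _

theorem euc_smul (a : ℝ) (z : ι → ℝ) : eucNorm (a • z) = |a| * eucNorm z := by
  simp only [euc_eq, WithLp.toLp_smul, norm_smul, Real.norm_eq_abs]

theorem euc_sq (z : ι → ℝ) : eucNorm z ^ 2 = ∑ i, z i ^ 2 :=
  Real.sq_sqrt (Finset.sum_nonneg fun i _ => sq_nonneg _)

theorem euc_le_of_sq {z : ι → ℝ} {c : ℝ} (hc : 0 ≤ c) (h : ∑ i, z i ^ 2 ≤ c ^ 2) :
    eucNorm z ≤ c := by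
  rw [← euc_sq] at h
  exact le_of_sq_le_sq h hc
  where le_of_sq_le_sq {a b : ℝ} (h : a ^ 2 ≤ b ^ 2) (hb : 0 ≤ b) : a ≤ b := by
          exact abs_le_of_sq_le_sq' h hb |>.2

theorem abs_le_euc (z : ι → ℝ) (i : ι) : |z i| ≤ eucNorm z := by
  rw [euc_eq]
  simpa using PiLp.norm_apply_le (WithLp.toLp 2 z : EuclideanSpace ℝ ι) i

theorem euc_zero_iff (z : ι → ℝ) : eucNorm z = 0 ↔ z = 0 := by
  rw [euc_eq, norm_eq_zero]; simp

theorem euc_single [DecidableEq ι] (i : ι) : eucNorm (Pi.single i (1 : ℝ)) = 1 := by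
  rw [eucNorm, Finset.sum_eq_single i] <;> simp +contextual [Pi.single_apply]

theorem euc_cont : Continuous (eucNorm : (ι → ℝ) → ℝ) := by
  unfold eucNorm; fun_prop

theorem euc_mulVec_bdd (A : Matrix ι ι ℝ) :
    ∃ K, 0 ≤ K ∧ ∀ z, eucNorm (A.mulVec z) ≤ K * eucNorm z := by
  classical
  refine ⟨‖Matrix.toEuclideanCLM (n := ι) (𝕜 := ℝ) A‖, norm_nonneg _, fun z => ?_⟩
  have := (Matrix.toEuclideanCLM (n := ι) (𝕜 := ℝ) A).le_opNorm (WithLp.toLp 2 z)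
  simpa [euc_eq] using this

theorem spec_le (A : Matrix ι ι ℝ) (z : ι → ℝ) :
    eucNorm (A.mulVec z) ≤ specNorm A * eucNorm z := by
  obtain ⟨K, hK, h⟩ := euc_mulVec_bdd A
  rcases (euc_nonneg z).eq_or_lt with h0 | h0
  · have := h z
    rw [← h0] at this ⊢
    simpa using this
  · have : eucNorm (A.mulVec ((eucNorm z)⁻¹ • z)) ≤ specNorm A := by
      apply le_csSup
      · refine ⟨K, ?_⟩
        rintro c ⟨w, hw, rfl⟩
        exact (h w).trans (mul_le_of_le_one_right hK hw)
      · refine ⟨_, ?_, rfl⟩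
        rw [euc_smul, abs_of_pos (inv_pos.2 h0), inv_mul_cancel₀ h0.ne']
    rw [Matrix.mulVec_smul, euc_smul, abs_of_pos (inv_pos.2 h0), inv_mul_le_iff₀ h0] at this
    linarith

theorem spec_le_of (A : Matrix ι ι ℝ) {K : ℝ} (hK : 0 ≤ K)
    (h : ∀ z, eucNorm (A.mulVec z) ≤ K * eucNorm z) : specNorm A ≤ K := by
  apply csSup_le
  · exact ⟨_, 0, by rw [(euc_zero_iff _).2 rfl]; exact zero_le_one, rfl⟩
  · rintro c ⟨w, hw, rfl⟩
    exact (h w).trans (mul_le_of_le_one_right hK hw)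

theorem opN_le (N : (ι → ℝ) → ℝ) (hge : ∀ z, eucNorm z ≤ N z) (κ : ℝ) (hκ : 0 < κ)
    (hle : ∀ z, N z ≤ κ * eucNorm z) (A : Matrix ι ι ℝ) (z : ι → ℝ) :
    N (A.mulVec z) ≤ opNorm N A * N z := by
  obtain ⟨K, hK, h⟩ := euc_mulVec_bdd A
  by_cases hz : z = 0
  · subst hz
    have h0 : N 0 = 0 := by
      have h1 := hle 0
      have h2 := hge 0
      rw [(euc_zero_iff _).2 rfl] at h1 h2
      linarith
    simp [h0]
  · have hpos : ∀ w : ι → ℝ, w ≠ 0 → 0 < N w := fun w hw =>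
      lt_of_lt_of_le ((euc_nonneg w).lt_of_ne fun h => hw ((euc_zero_iff w).1 h.symm)) (hge w)
    rw [← div_le_iff₀ (hpos z hz)]
    apply le_csSup
    · refine ⟨κ * K, ?_⟩
      rintro c ⟨w, hw, rfl⟩
      rw [div_le_iff₀ (hpos w hw)]
      calc N (A.mulVec w) ≤ κ * eucNorm (A.mulVec w) := hle _
        _ ≤ κ * (K * N w) := by
            have := (h w).trans (mul_le_mul_of_nonneg_left (hge w) hK)
            gcongr
        _ = _ := by ring
    · exact ⟨z, hz, rfl⟩

theorem diag_euc_le [DecidableEq ι] (d : ι → ℝ) {c : ℝ} (hc : 0 ≤ c) (hd : ∀ i, |d i| ≤ c)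
    (z : ι → ℝ) : eucNorm ((Matrix.diagonal d).mulVec z) ≤ c * eucNorm z := by
  apply euc_le_of_sq (mul_nonneg hc (euc_nonneg z))
  rw [mul_pow, euc_sq, Finset.mul_sum]
  apply Finset.sum_le_sum
  intro i _
  rw [Matrix.mulVec_diagonal, mul_pow]
  have : d i ^ 2 ≤ c ^ 2 := sq_le_sq' (by linarith [(abs_le.1 (hd i)).1]) (abs_le.1 (hd i)).2
  gcongr

theorem kron_mulVec {n p : ℕ} (A : Matrix (Fin n) (Fin n) ℝ) (z : Fin n × Fin p → ℝ)
    (q : Fin n × Fin p) :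
    (A ⊗ₖ (1 : Matrix (Fin p) (Fin p) ℝ)).mulVec z q = ∑ l, A q.1 l * z (l, q.2) := by
  rw [Matrix.mulVec, dotProduct, Fintype.sum_prod_type]
  apply Finset.sum_congr rfl
  intro l _
  simp [Matrix.kroneckerMap_apply, Matrix.one_apply]

end helpers

theorem sum_block_zero {n p : ℕ} (f : Fin n → (Fin p → ℝ) → ℝ)
    (g : Fin n → (Fin p → ℝ) → Fin p → ℝ) (hgrad : ∀ i, IsGradient (f i) (g i))
    (xs : Fin p → ℝ) (hmin : ∀ w, ∑ i, f i xs ≤ ∑ i, f i w) (j : Fin p) :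
    ∑ i, g i xs j = 0 := by
  have h1 : HasFDerivAt (fun w => ∑ i, f i w)
      (∑ i, ∑ j, g i xs j • (ContinuousLinearMap.proj j : (Fin p → ℝ) →L[ℝ] ℝ)) xs :=
    HasFDerivAt.fun_sum fun i _ => hgrad i xs
  have h2 : IsLocalMin (fun w => ∑ i, f i w) xs := Filter.Eventually.of_forall hmin
  have h3 := h2.hasFDerivAt_eq_zero h1
  have h4 := congrArg (fun T : (Fin p → ℝ) →L[ℝ] ℝ => T (Pi.single j 1)) h3
  simpa [Pi.single_apply, ContinuousLinearMap.sum_apply] using h4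

theorem gradf_lip {n p : ℕ} (g : Fin n → (Fin p → ℝ) → Fin p → ℝ) (L : ℝ) (hL : 0 ≤ L)
    (hLip : ∀ i x x', eucNorm (g i x - g i x') ≤ L * eucNorm (x - x'))
    (z w : Fin n × Fin p → ℝ) :
    eucNorm (gradf g z - gradf g w) ≤ L * eucNorm (z - w) := by
  apply euc_le_of_sq (mul_nonneg hL (euc_nonneg _))
  rw [mul_pow, euc_sq, Fintype.sum_prod_type, Fintype.sum_prod_type, Finset.mul_sum]
  apply Finset.sum_le_sum
  intro i _
  have h := hLip i (fun j => z (i, j)) (fun j => w (i, j))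
  have h2 := pow_le_pow_left₀ (euc_nonneg _) h 2
  rw [mul_pow, euc_sq, euc_sq] at h2
  exact h2

/-- the all-ones averaging operator `(1 1^T) ⊗ I_p` -/
def onesOp {n p : ℕ} (z : Fin n × Fin p → ℝ) : Fin n × Fin p → ℝ := fun q => ∑ i, z (i, q.2)

theorem onesOp_le {n p : ℕ} (z : Fin n × Fin p → ℝ) :
    eucNorm (onesOp z) ≤ n * eucNorm z := by
  apply euc_le_of_sq (mul_nonneg (Nat.cast_nonneg n) (euc_nonneg _))
  rw [mul_pow, euc_sq, Fintype.sum_prod_type, Fintype.sum_prod_type]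
  simp only [onesOp]
  rw [Finset.sum_const, Finset.card_univ, Fintype.card_fin, nsmul_eq_mul, pow_two, mul_assoc]
  gcongr
  rw [Finset.sum_comm, Finset.mul_sum]
  apply Finset.sum_le_sum
  intro j _
  simpa using sq_sum_le_card_mul_sum_sq (s := Finset.univ) (f := fun i => z (i, j))

/-- Lemma 6: for `k ≥ 1`,
`‖x(k+1)−x̂(k+1)‖_C ≤ (σ_C + ακ₄nL)‖x(k)−x̂(k)‖_C + (κ₂|||R|||_R + ακ₄ṽL)‖x(k)−x(k−1)‖_R
  + ακ₄nL‖x̂(k)−x*_vec‖ + ακ₄(2+v)ṽ²√n κ₃ σ_R^{k−1} ‖∇f(x(k))‖`. -/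
theorem stmt13 (n p : ℕ) (hn : 1 ≤ n) (hp : 1 ≤ p) (Rb : Matrix (Fin n) (Fin n) ℝ)
    (hnonneg : ∀ i j, 0 ≤ Rb i j) (hrow : ∀ i, ∑ j, Rb i j = 1)
    (hdiag : ∀ i, 0 < Rb i i)
    (hirr : ∀ i j, ∃ k : ℕ, 0 < (Rb ^ k) i j)
    (π : Fin n → ℝ) (hπpos : ∀ i, 0 < π i) (hπsum : ∑ i, π i = 1)
    (hπstat : Matrix.vecMul π Rb = π)
    (f : Fin n → (Fin p → ℝ) → ℝ) (g : Fin n → (Fin p → ℝ) → Fin p → ℝ)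
    (μ L : ℝ) (hμ : 0 < μ) (hμL : μ ≤ L)
    (hgrad : ∀ i, IsGradient (f i) (g i))
    (hLip : ∀ i x x', eucNorm (g i x - g i x') ≤ L * eucNorm (x - x'))
    (hsc : ∀ i x x',
      f i x + (∑ j, g i x j * (x' j - x j)) + μ / 2 * eucNorm (x' - x) ^ 2 ≤ f i x')
    (xstar : Fin p → ℝ)
    (hmin : ∀ w, ∑ i, f i xstar ≤ ∑ i, f i w)
    (huniq : ∀ w, (∀ w', ∑ i, f i w ≤ ∑ i, f i w') → w = xstar)
    (NR NC : (Fin n × Fin p → ℝ) → ℝ)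
    (hNRtri : ∀ z w, NR (z + w) ≤ NR z + NR w)
    (hNRhom : ∀ (a : ℝ) z, NR (a • z) = |a| * NR z)
    (hNRdef : ∀ z, NR z = 0 ↔ z = 0)
    (hNCtri : ∀ z w, NC (z + w) ≤ NC z + NC w)
    (hNChom : ∀ (a : ℝ) z, NC (a • z) = |a| * NC z)
    (hNCdef : ∀ z, NC z = 0 ↔ z = 0)
    (hNRge : ∀ z, eucNorm z ≤ NR z) (hNCge : ∀ z, eucNorm z ≤ NC z)
    (κ₁ κ₂ κ₃ κ₄ : ℝ) (hκ₁ : 0 < κ₁) (hκ₂ : 0 < κ₂) (hκ₃ : 0 < κ₃) (hκ₄ : 0 < κ₄)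
    (hκ₁R : ∀ z, NR z ≤ κ₁ * NC z) (hκ₂C : ∀ z, NC z ≤ κ₂ * NR z)
    (hκ₃R : ∀ z, NR z ≤ κ₃ * eucNorm z) (hκ₄C : ∀ z, NC z ≤ κ₄ * eucNorm z)
    (v vt : ℝ) (hv : v = ⨆ k : ℕ, specNorm (VK n p Rb k))
    (hvt : vt = ⨆ k : ℕ, specNorm (VtinvK n p Rb k))
    (σR : ℝ) (hσRdef : σR = opNorm NR (RK n p Rb - VinfK n p π))
    (hσR0 : 0 < σR) (hσR1 : σR < 1)
    (α β : ℝ) (hα0 : 0 < α) (hβ0 : 0 < β) (hαβ : α * β < 1)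
    (x y : ℕ → (Fin n × Fin p → ℝ)) (hy0 : y 0 = 0)
    (hxrec : ∀ k, x (k + 1) =
      (RK n p Rb).mulVec (x k) - α • (y k + (VtinvK n p Rb k).mulVec (gradf g (x k))))
    (hyrec : ∀ k, y (k + 1) = y k + β • ((1 - RK n p Rb).mulVec (x (k + 1))))
    (σC : ℝ) (hσC0 : 0 < σC) (hσC1 : σC < 1)
    (hσC : ∀ z : Fin n × Fin p → ℝ,
      NC (((1 - α * β) • (1 : Matrix (Fin n × Fin p) (Fin n × Fin p) ℝ)
            + (α * β) • RK n p Rb).mulVec z - (VinfK n p π).mulVec z) ≤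
        σC * NC (z - (VinfK n p π).mulVec z)) :
    ∀ k : ℕ, 1 ≤ k →
      NC (x (k + 1) - (VinfK n p π).mulVec (x (k + 1))) ≤
        (σC + α * κ₄ * n * L) * NC (x k - (VinfK n p π).mulVec (x k))
          + (κ₂ * opNorm NR (RK n p Rb) + α * κ₄ * vt * L) * NR (x k - x (k - 1))
          + α * κ₄ * n * L * eucNorm ((VinfK n p π).mulVec (x k) - starVec n p xstar)
          + α * κ₄ * (2 + v) * vt ^ 2 * Real.sqrt n * κ₃ * σR ^ (k - 1)
              * eucNorm (gradf g (x k)) := by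
  intro k hk
  obtain ⟨m, rfl⟩ : ∃ m, k = m + 1 := ⟨k - 1, by omega⟩
  simp only [Nat.add_sub_cancel]
  set R := RK n p Rb with hR
  set W := VinfK n p π with hW
  have hL : 0 ≤ L := hμ.le.trans hμL
  have hNR0 : ∀ z, 0 ≤ NR z := fun z => (euc_nonneg z).trans (hNRge z)
  have hNC0 : ∀ z, 0 ≤ NC z := fun z => (euc_nonneg z).trans (hNCge z)
  have hneg : ∀ z, NC (-z) = NC z := fun z => by
    have := hNChom (-1) z
    simpa using this
  have enegl : ∀ z : Fin n × Fin p → ℝ, eucNorm (-z) = eucNorm z := fun z => by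
    have := euc_smul (-1) z
    simpa using this
  -- algebra of R and W
  have hRone : ∀ z, R.mulVec (W.mulVec z) = W.mulVec z := by
    intro z; funext q
    simp only [hR, hW, RK, VinfK, kron_mulVec, Matrix.of_apply]
    rw [← Finset.sum_mul, hrow, one_mul]
  have hWW : ∀ z, W.mulVec (W.mulVec z) = W.mulVec z := by
    intro z; funext q
    simp only [hW, VinfK, kron_mulVec, Matrix.of_apply]
    rw [← Finset.sum_mul, hπsum, one_mul]
  have hWR : ∀ z, W.mulVec (R.mulVec z) = W.mulVec z := by
    intro z; funext q
    simp only [hR, hW, RK, VinfK, kron_mulVec, Matrix.of_apply, Finset.mul_sum]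
    rw [Finset.sum_comm]
    apply Finset.sum_congr rfl
    intro l _
    have := congrFun hπstat l
    rw [Matrix.vecMul, dotProduct] at this
    conv_rhs => rw [← this, Finset.sum_mul]
    apply Finset.sum_congr rfl
    intro i _; ring
  have hVK : ∀ j, VK n p Rb j = R ^ j := by
    intro j
    induction j with
    | zero => simp [VK]
    | succ j ih =>
      rw [pow_succ, ← ih, hR, VK, VK, RK, ← Matrix.mul_kronecker_mul, pow_succ, one_mul]
  have hVsucc : ∀ j z, (VK n p Rb (j + 1)).mulVec z = R.mulVec ((VK n p Rb j).mulVec z) := by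
    intro j z
    rw [hVK, hVK, pow_succ', Matrix.mulVec_mulVec]
  have hWV : ∀ j z, W.mulVec ((VK n p Rb j).mulVec z) = W.mulVec z := by
    intro j z
    induction j with
    | zero => simp [hVK]
    | succ j ih => rw [hVsucc, hWR, ih]
  have hcontr : ∀ z, NR ((R - W).mulVec z) ≤ σR * NR z := by
    intro z
    rw [hσRdef]
    exact opN_le NR hNRge κ₃ hκ₃ hκ₃R _ z
  have hgeo : ∀ j z, NR ((VK n p Rb (j + 1)).mulVec z - W.mulVec z) ≤ σR ^ (j + 1) * NR z := by
    intro j z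
    induction j with
    | zero =>
      have := hcontr z
      rw [Matrix.sub_mulVec] at this
      simpa [hVK] using this
    | succ j ih =>
      have e : (VK n p Rb (j + 1 + 1)).mulVec z - W.mulVec z
          = (R - W).mulVec ((VK n p Rb (j + 1)).mulVec z - W.mulVec z) := by
        rw [Matrix.sub_mulVec, Matrix.mulVec_sub, Matrix.mulVec_sub, hRone, hWW, hWV, hVsucc (j+1)]
        abel
      rw [e, pow_succ', mul_assoc]
      exact (hcontr _).trans (mul_le_mul_of_nonneg_left ih hσR0.le)
  have hκ₃1 : 1 ≤ κ₃ := by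
    have h1 := hNRge (Pi.single (⟨0, hn⟩, ⟨0, hp⟩) 1)
    have h2 := hκ₃R (Pi.single (⟨0, hn⟩, ⟨0, hp⟩) 1)
    rw [euc_single] at h1 h2
    linarith
  have hπle : ∀ i, π i ≤ 1 := fun i => by
    rw [← hπsum]
    exact Finset.single_le_sum (fun j _ => (hπpos j).le) (Finset.mem_univ i)
  have hdiagK : ∀ j i, |(Rb ^ j) i i - π i| ≤ κ₃ * σR ^ j := by
    intro j i
    cases j with
    | zero =>
      simp only [pow_zero, Matrix.one_apply_eq, mul_one]
      rw [abs_le]; constructor <;> linarith [hπle i, hπpos i]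
    | succ j =>
      have h1 := hgeo j (Pi.single (i, ⟨0, hp⟩) 1)
      have h2 := hκ₃R (Pi.single (i, ⟨0, hp⟩) 1)
      rw [euc_single, mul_one] at h2
      have h3 := (abs_le_euc _ (i, (⟨0, hp⟩ : Fin p))).trans ((hNRge _).trans h1)
      have h4 : ((VK n p Rb (j + 1)).mulVec (Pi.single (i, ⟨0, hp⟩) 1)
          - W.mulVec (Pi.single (i, ⟨0, hp⟩) 1)) (i, (⟨0, hp⟩ : Fin p))
          = (Rb ^ (j + 1)) i i - π i := by
        simp [hW, VK, VinfK, Matrix.kroneckerMap_apply]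
      rw [h4] at h3
      refine h3.trans ?_
      rw [mul_comm]
      gcongr
  have hσlim : Tendsto (fun j : ℕ => σR ^ j) atTop (nhds 0) :=
    tendsto_pow_atTop_nhds_zero_of_lt_one hσR0.le hσR1
  have hdlim : ∀ i, Tendsto (fun j : ℕ => (Rb ^ j) i i) atTop (nhds (π i)) := by
    intro i
    rw [tendsto_iff_norm_sub_tendsto_zero]
    refine squeeze_zero (fun _ => norm_nonneg _) (fun j => hdiagK j i) ?_
    simpa using hσlim.const_mul κ₃
  have hpownn : ∀ j i l, 0 ≤ (Rb ^ j) i l := by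
    intro j
    induction j with
    | zero => intro i l; rw [pow_zero, Matrix.one_apply]; split_ifs <;> norm_num
    | succ j ih =>
      intro i l
      rw [pow_succ, Matrix.mul_apply]
      exact Finset.sum_nonneg fun q _ => mul_nonneg (ih _ _) (hnonneg _ _)
  have hpowpos : ∀ j i, 0 < (Rb ^ j) i i := by
    intro j i
    induction j with
    | zero => simp
    | succ j ih =>
      rw [pow_succ, Matrix.mul_apply]
      exact lt_of_lt_of_le (mul_pos ih (hdiag i)) (Finset.single_le_sum
        (f := fun q => (Rb ^ j) i q * Rb q i)
        (fun q _ => mul_nonneg (hpownn _ _ _) (hnonneg _ _)) (Finset.mem_univ i))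
  -- vt bound
  have hinvbdd : ∀ i, ∃ c, ∀ j, ((Rb ^ j) i i)⁻¹ ≤ c := by
    intro i
    obtain ⟨c, hc⟩ := ((hdlim i).inv₀ (hπpos i).ne').bddAbove_range
    exact ⟨c, fun j => hc ⟨j, rfl⟩⟩
  choose c hc using hinvbdd
  have hc0 : ∀ i, 0 ≤ c i := fun i => (inv_nonneg.2 (hpowpos 0 i).le).trans (hc i 0)
  have hvtbdd : BddAbove (Set.range fun j : ℕ => specNorm (VtinvK n p Rb j)) := by
    refine ⟨∑ i, c i, ?_⟩
    rintro _ ⟨j, rfl⟩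
    have hs : 0 ≤ ∑ i, c i := Finset.sum_nonneg fun i _ => hc0 i
    refine spec_le_of _ hs (fun z => diag_euc_le _ hs (fun q => ?_) z)
    rw [abs_of_pos (inv_pos.2 (hpowpos j q.1))]
    exact (hc q.1 j).trans (Finset.single_le_sum (fun i _ => hc0 i) (Finset.mem_univ q.1))
  have hvtspec : ∀ j, specNorm (VtinvK n p Rb j) ≤ vt := fun j => by
    rw [hvt]; exact le_ciSup hvtbdd j
  have hvtD : ∀ j z, eucNorm ((VtinvK n p Rb j).mulVec z) ≤ vt * eucNorm z := fun j z =>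
    (spec_le _ z).trans (mul_le_mul_of_nonneg_right (hvtspec j) (euc_nonneg z))
  have hvtinv : ∀ j i, ((Rb ^ j) i i)⁻¹ ≤ vt := by
    intro j i
    have h1 := hvtD j (Pi.single (i, ⟨0, hp⟩) 1)
    rw [euc_single, mul_one] at h1
    have h2 := (abs_le_euc _ (i, (⟨0, hp⟩ : Fin p))).trans h1
    rw [VtinvK, Matrix.mulVec_diagonal] at h2
    simp only [Pi.single_eq_same, mul_one] at h2
    exact (le_abs_self _).trans h2
  have hvt0 : 0 < vt := (inv_pos.2 (hpowpos 0 ⟨0, hn⟩)).trans_le (hvtinv 0 ⟨0, hn⟩)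
  have hvtπ : ∀ i, (π i)⁻¹ ≤ vt := fun i =>
    le_of_tendsto ((hdlim i).inv₀ (hπpos i).ne') (Eventually.of_forall fun j => hvtinv j i)
  -- v bound
  have hvbdd : BddAbove (Set.range fun j : ℕ => specNorm (VK n p Rb j)) := by
    obtain ⟨K, hK, hKW⟩ := euc_mulVec_bdd W
    refine ⟨K + κ₃ + 1, ?_⟩
    rintro _ ⟨j, rfl⟩
    refine spec_le_of _ (by positivity) (fun z => ?_)
    cases j with
    | zero =>
      simp only [hVK, pow_zero, Matrix.one_mulVec]
      nlinarith [euc_nonneg z, mul_nonneg hK (euc_nonneg z), mul_nonneg hκ₃.le (euc_nonneg z)]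
    | succ j =>
      have h1 := (hNRge _).trans (hgeo j z)
      have h2 : σR ^ (j + 1) * NR z ≤ NR z :=
        mul_le_of_le_one_left (hNR0 z) (pow_le_one₀ hσR0.le hσR1.le)
      have h3 := euc_add ((VK n p Rb (j + 1)).mulVec z - W.mulVec z) (W.mulVec z)
      rw [sub_add_cancel] at h3
      linarith [hκ₃R z, hKW z, euc_nonneg z]
  have hvV : ∀ j z, eucNorm ((VK n p Rb j).mulVec z) ≤ v * eucNorm z := fun j z =>
    (spec_le _ z).trans (mul_le_mul_of_nonneg_right
      (by rw [hv]; exact le_ciSup hvbdd j) (euc_nonneg z))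
  have hv0 : 0 ≤ v := by
    have h1 := hvV 0 (Pi.single (⟨0, hn⟩, ⟨0, hp⟩) 1)
    rw [euc_single, mul_one] at h1
    exact (euc_nonneg _).trans h1
  have hvW : ∀ z, eucNorm (W.mulVec z) ≤ v * eucNorm z := by
    intro z
    have h0 : Tendsto (fun j : ℕ => v * eucNorm z + σR ^ (j + 1) * NR z) atTop
        (nhds (v * eucNorm z + 0 * NR z)) :=
      (((tendsto_add_atTop_iff_nat 1).2 hσlim).mul_const _).const_add _
    rw [zero_mul, add_zero] at h0
    refine ge_of_tendsto h0 (Eventually.of_forall fun j => ?_)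
    have h1 := (hNRge _).trans (hgeo j z)
    have h3 := euc_add (-((VK n p Rb (j + 1)).mulVec z - W.mulVec z)) ((VK n p Rb (j + 1)).mulVec z)
    rw [enegl, neg_sub, sub_add_cancel] at h3
    linarith [hvV (j + 1) z]
  -- W y = 0
  have hWy : ∀ j, W.mulVec (y j) = 0 := by
    intro j
    induction j with
    | zero => rw [hy0, Matrix.mulVec_zero]
    | succ j ih =>
      rw [hyrec, Matrix.mulVec_add, ih, Matrix.mulVec_smul, Matrix.sub_mulVec, Matrix.mulVec_sub,
        hWR, Matrix.one_mulVec, sub_self, smul_zero, add_zero]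
  -- abbreviations
  set G := gradf g (x (m + 1)) with hG
  set G' := gradf g (x m) with hG'
  set D := VtinvK n p Rb (m + 1) with hD
  set D' := VtinvK n p Rb m with hD'
  set X := x (m + 1) with hX
  set S := starVec n p xstar with hS
  have hxhat : W.mulVec (x (m + 1 + 1)) = W.mulVec X - α • W.mulVec (D.mulVec G) := by
    rw [hxrec (m + 1), Matrix.mulVec_sub, hWR, Matrix.mulVec_smul, Matrix.mulVec_add, hWy, zero_add]
  have hx2 : x (m + 1 + 1) = ((1 - α * β) • (1 : Matrix (Fin n × Fin p) (Fin n × Fin p) ℝ)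
            + (α * β) • R).mulVec X + R.mulVec (X - x m) - α • (D.mulVec G - D'.mulVec G') := by
    have e1 := hxrec (m + 1)
    have e2 := hxrec m
    rw [hyrec m] at e1
    rw [← hX, ← hG, ← hD] at e1
    rw [← hX, ← hG', ← hD'] at e2
    rw [e1]
    simp only [Matrix.add_mulVec, Matrix.smul_mulVec, Matrix.sub_mulVec, Matrix.one_mulVec,
      Matrix.mulVec_sub]
    funext q
    have e3 := congrFun e2 q
    simp only [Pi.add_apply, Pi.sub_apply, Pi.smul_apply, smul_eq_mul] at e3 ⊢
    linear_combination -e3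
  have hdec : x (m + 1 + 1) - W.mulVec (x (m + 1 + 1)) =
      ((((1 - α * β) • (1 : Matrix (Fin n × Fin p) (Fin n × Fin p) ℝ)
            + (α * β) • R).mulVec X - W.mulVec X) + R.mulVec (X - x m)) +
      α • ((((W.mulVec (D.mulVec G) - onesOp G) + -(D.mulVec G - D'.mulVec G))
        + -(D'.mulVec (G - G'))) + onesOp G) := by
    rw [hxhat, hx2, Matrix.mulVec_sub D']
    simp only [smul_add, smul_sub, smul_neg]
    abel
  -- bounds
  have b1 : eucNorm (D'.mulVec (G - G')) ≤ vt * L * NR (X - x m) := by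
    refine (hvtD m _).trans ?_
    have h1 := gradf_lip g L hL hLip X (x m)
    rw [mul_assoc]
    refine mul_le_mul_of_nonneg_left (h1.trans ?_) hvt0.le
    exact mul_le_mul_of_nonneg_left (hNRge _) hL
  have hmono : σR ^ (m + 1) ≤ σR ^ m := pow_le_pow_of_le_one hσR0.le hσR1.le (Nat.le_succ m)
  have b2 : eucNorm (D.mulVec G - D'.mulVec G) ≤ 2 * vt ^ 2 * κ₃ * σR ^ m * eucNorm G := by
    rw [← Matrix.sub_mulVec, hD, hD', VtinvK, VtinvK, Matrix.diagonal_sub]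
    refine diag_euc_le _ (by positivity) (fun q => ?_) G
    have p1 := hpowpos (m + 1) q.1
    have p2 := hpowpos m q.1
    rw [inv_sub_inv p1.ne' p2.ne', abs_div, abs_of_pos (mul_pos p1 p2), div_eq_mul_inv, mul_inv]
    have t1 : |(Rb ^ m) q.1 q.1 - (Rb ^ (m + 1)) q.1 q.1| ≤ 2 * κ₃ * σR ^ m := by
      have h1 := hdiagK m q.1
      have h2 := hdiagK (m + 1) q.1
      have h3 := mul_le_mul_of_nonneg_left hmono hκ₃.le
      rw [abs_le] at h1 h2 ⊢
      constructor <;> linarith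
    calc _ ≤ (2 * κ₃ * σR ^ m) * (vt * vt) := by
          have := hvtinv (m + 1) q.1
          have := hvtinv m q.1
          gcongr
      _ = _ := by ring
  have hones : onesOp G = W.mulVec ((Matrix.diagonal fun q : Fin n × Fin p => (π q.1)⁻¹).mulVec G) := by
    funext q
    rw [hW, VinfK, kron_mulVec, onesOp]
    apply Finset.sum_congr rfl
    intro i _
    rw [Matrix.mulVec_diagonal, Matrix.of_apply, mul_inv_cancel_left₀ (hπpos i).ne']
  have b3 : eucNorm (W.mulVec (D.mulVec G) - onesOp G) ≤ v * vt ^ 2 * κ₃ * σR ^ m * eucNorm G := by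
    rw [hones, ← Matrix.mulVec_sub, ← Matrix.sub_mulVec, hD, VtinvK, Matrix.diagonal_sub]
    refine (hvW _).trans ?_
    have : eucNorm ((Matrix.diagonal fun q : Fin n × Fin p =>
        ((Rb ^ (m + 1)) q.1 q.1)⁻¹ - (π q.1)⁻¹).mulVec G) ≤ vt ^ 2 * κ₃ * σR ^ m * eucNorm G := by
      refine diag_euc_le _ (by positivity) (fun q => ?_) G
      have p1 := hpowpos (m + 1) q.1
      have p2 := hπpos q.1
      rw [inv_sub_inv p1.ne' p2.ne', abs_div, abs_of_pos (mul_pos p1 p2), div_eq_mul_inv, mul_inv,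
        abs_sub_comm]
      have t1 : |(Rb ^ (m + 1)) q.1 q.1 - π q.1| ≤ κ₃ * σR ^ m :=
        (hdiagK (m + 1) q.1).trans (mul_le_mul_of_nonneg_left hmono hκ₃.le)
      calc _ ≤ (κ₃ * σR ^ m) * (vt * vt) := by
            have := hvtinv (m + 1) q.1
            have := hvtπ q.1
            have := inv_nonneg.2 p2.le
            gcongr
        _ = _ := by ring
    calc _ ≤ v * (vt ^ 2 * κ₃ * σR ^ m * eucNorm G) := mul_le_mul_of_nonneg_left this hv0
      _ = _ := by ring
  have b4 : eucNorm (onesOp G) ≤ n * L * (NC (X - W.mulVec X) + eucNorm (W.mulVec X - S)) := by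
    have e : onesOp G = onesOp (G - gradf g S) := by
      funext q
      have := sum_block_zero f g hgrad xstar hmin q.2
      simp only [onesOp, Pi.sub_apply, Finset.sum_sub_distrib]
      have h2 : ∑ i, gradf g S (i, q.2) = 0 := this
      rw [h2, sub_zero]
    rw [e]
    refine (onesOp_le _).trans ?_
    rw [mul_assoc]
    refine mul_le_mul_of_nonneg_left ((gradf_lip g L hL hLip X S).trans ?_) (Nat.cast_nonneg n)
    refine mul_le_mul_of_nonneg_left ?_ hL
    have := euc_add (X - W.mulVec X) (W.mulVec X - S)
    rw [sub_add_sub_cancel] at this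
    linarith [hNCge (X - W.mulVec X)]
  have bsum : eucNorm ((((W.mulVec (D.mulVec G) - onesOp G) + -(D.mulVec G - D'.mulVec G))
        + -(D'.mulVec (G - G'))) + onesOp G) ≤
      (2 + v) * vt ^ 2 * κ₃ * σR ^ m * eucNorm G + vt * L * NR (X - x m)
      + n * L * (NC (X - W.mulVec X) + eucNorm (W.mulVec X - S)) := by
    have t1 := euc_add (((W.mulVec (D.mulVec G) - onesOp G) + -(D.mulVec G - D'.mulVec G))
        + -(D'.mulVec (G - G'))) (onesOp G)
    have t2 := euc_add ((W.mulVec (D.mulVec G) - onesOp G) + -(D.mulVec G - D'.mulVec G))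
        (-(D'.mulVec (G - G')))
    have t3 := euc_add (W.mulVec (D.mulVec G) - onesOp G) (-(D.mulVec G - D'.mulVec G))
    rw [enegl] at t2 t3
    linarith
  have bR : NC (R.mulVec (X - x m)) ≤ κ₂ * opNorm NR R * NR (X - x m) := by
    refine (hκ₂C _).trans ?_
    rw [mul_assoc]
    exact mul_le_mul_of_nonneg_left (opN_le NR hNRge κ₃ hκ₃ hκ₃R R _) hκ₂.le
  have hsqrt : (1 : ℝ) ≤ Real.sqrt n := Real.one_le_sqrt.2 (by exact_mod_cast hn)
  have hlast : (2 + v) * vt ^ 2 * κ₃ * σR ^ m * eucNorm G ≤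
      (2 + v) * vt ^ 2 * κ₃ * σR ^ m * eucNorm G * Real.sqrt n :=
    le_mul_of_one_le_right (by have := euc_nonneg G; positivity) hsqrt
  rw [hdec]
  refine (hNCtri _ _).trans ?_
  rw [hNChom, abs_of_pos hα0]
  have f1 := (hNCtri (((1 - α * β) • (1 : Matrix (Fin n × Fin p) (Fin n × Fin p) ℝ)
            + (α * β) • R).mulVec X - W.mulVec X) (R.mulVec (X - x m)))
  have f2 := hσC X
  have f3 := mul_le_mul_of_nonneg_left ((hκ₄C _).trans
    (mul_le_mul_of_nonneg_left (bsum.trans (add_le_add_left (add_le_add_left hlast _) _)) hκ₄.le))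
    hα0.le
  refine (add_le_add (f1.trans (add_le_add f2 bR)) f3).trans (le_of_eq ?_)
  ring
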